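/- arXiv:2308.04967 — 3 statements merged into one kernel-verified Lean document; each statement's English description precedes it below -/
import Mathlib

section
/- Let β > 0, let Ω ⊂ ℝ² be a measurable set of finite positive Lebesgue measure |Ω|, let Z ∈ ℝ^{2×2} have entries Z₁₁ = 1 and Zᵢⱼ = 0 otherwise, and let ũ(x₁,x₂) = (sin x₁, (1+1/(5β))·x₂, cos x₁). Then the reshaped energy satisfies Ẽ[ũ] = ½∫_Ω |D²ũ|² dx + Σ_{i,j=1}^{2} ∫_Ω ∂ᵢⱼũ·(∂₁ũ × ∂₂ũ) Zᵢⱼ dx + ½|Ω||Z|² = −|Ω|/(5β). -/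
open MeasureTheory Matrix

noncomputable section

/-- Partial derivative `∂ᵢ u` of a map `u : ℝ² → ℝ³`. -/
def pd (i : Fin 2) (u : (Fin 2 → ℝ) → (Fin 3 → ℝ)) (x : Fin 2 → ℝ) : Fin 3 → ℝ :=
  fderiv ℝ u x (Pi.single i 1)

/-- Second partial derivative `∂ᵢⱼ u = ∂ᵢ (∂ⱼ u)`. -/
def pd2 (i j : Fin 2) (u : (Fin 2 → ℝ) → (Fin 3 → ℝ)) (x : Fin 2 → ℝ) : Fin 3 → ℝ :=
  fderiv ℝ (pd j u) x (Pi.single i 1)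

/-- Jacobian `∇u` as a 3×2 matrix whose columns are `∂₁u` and `∂₂u`. -/
def grad (u : (Fin 2 → ℝ) → (Fin 3 → ℝ)) (x : Fin 2 → ℝ) : Matrix (Fin 3) (Fin 2) ℝ :=
  Matrix.of fun a i => pd i u x a

/-- Squared Frobenius norm of a matrix. -/
def frob2sq {m n : Type*} [Fintype m] [Fintype n] (M : Matrix m n ℝ) : ℝ :=
  ∑ i, ∑ j, (M i j) ^ 2

/-- The normal `n(u) = ∂₁u × ∂₂u`. -/
def nrm (u : (Fin 2 → ℝ) → (Fin 3 → ℝ)) (x : Fin 2 → ℝ) : Fin 3 → ℝ :=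
  crossProduct (pd 0 u x) (pd 1 u x)

/-- Second fundamental form `H(u)`, `Hᵢⱼ(u) = n(u)·∂ᵢⱼu`. -/
def sff (u : (Fin 2 → ℝ) → (Fin 3 → ℝ)) (x : Fin 2 → ℝ) : Matrix (Fin 2) (Fin 2) ℝ :=
  Matrix.of fun i j => ∑ k, nrm u x k * pd2 i j u x k

/-- Bending energy `E[u] = ½ ∫_Ω |H(u)+Z|²_F dx` (zero forcing). -/
def Ebend (Ω : Set (Fin 2 → ℝ)) (Z : Matrix (Fin 2) (Fin 2) ℝ)
    (u : (Fin 2 → ℝ) → (Fin 3 → ℝ)) : ℝ :=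
  (1/2) * ∫ x in Ω, frob2sq (sff u x + Z)

/-- Reshaped energy `Ẽ[u] = ½∫_Ω|D²u|² dx + Σᵢⱼ ∫_Ω ∂ᵢⱼu·(∂₁u×∂₂u) Zᵢⱼ dx + ½|Ω||Z|²_F`. -/
def Etilde (Ω : Set (Fin 2 → ℝ)) (Z : Matrix (Fin 2) (Fin 2) ℝ)
    (u : (Fin 2 → ℝ) → (Fin 3 → ℝ)) : ℝ :=
  (1/2) * (∫ x in Ω, ∑ i, ∑ j, ∑ k, (pd2 i j u x k) ^ 2)
  + (∑ i, ∑ j, (∫ x in Ω, ∑ k, pd2 i j u x k * nrm u x k) * Z i j)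
  + (1/2) * (volume Ω).toReal * frob2sq Z

/-- Isometry defect `C[u] = ‖(∇u)ᵀ∇u − Id₂‖_{L²(Ω)}`. -/
def Cdef (Ω : Set (Fin 2 → ℝ)) (u : (Fin 2 → ℝ) → (Fin 3 → ℝ)) : ℝ :=
  Real.sqrt (∫ x in Ω, frob2sq ((grad u x)ᵀ * grad u x - 1))

/-- Penalized reshaped energy `Ĩ[u] = Ẽ[u] + β C[u]²`. -/
def Itilde (β : ℝ) (Ω : Set (Fin 2 → ℝ)) (Z : Matrix (Fin 2) (Fin 2) ℝ)
    (u : (Fin 2 → ℝ) → (Fin 3 → ℝ)) : ℝ :=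
  Etilde Ω Z u + β * (Cdef Ω u) ^ 2


/-- Partial derivatives of a map whose outer components depend on the first coordinate only and
whose middle component depends on the second coordinate only. -/
lemma pd_of_hasDerivAt {f g h f' g' h' : ℝ → ℝ} (hf : ∀ t, HasDerivAt f (f' t) t)
    (hg : ∀ t, HasDerivAt g (g' t) t) (hh : ∀ t, HasDerivAt h (h' t) t) :
    pd 0 (fun x => ![f (x 0), g (x 1), h (x 0)]) = (fun x => ![f' (x 0), 0, h' (x 0)]) ∧
    pd 1 (fun x => ![f (x 0), g (x 1), h (x 0)]) = (fun x => ![0, g' (x 1), 0]) := by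
  have key : ∀ x : Fin 2 → ℝ, HasFDerivAt (fun x : Fin 2 → ℝ => ![f (x 0), g (x 1), h (x 0)])
      (ContinuousLinearMap.pi
        ![f' (x 0) • ContinuousLinearMap.proj (R := ℝ) (φ := fun _ : Fin 2 => ℝ) 0,
          g' (x 1) • ContinuousLinearMap.proj (R := ℝ) (φ := fun _ : Fin 2 => ℝ) 1,
          h' (x 0) • ContinuousLinearMap.proj (R := ℝ) (φ := fun _ : Fin 2 => ℝ) 0]) x := by
    intro x
    rw [hasFDerivAt_pi']
    intro i
    fin_cases i
    · exact (hf (x 0)).comp_hasFDerivAt x (hasFDerivAt_apply 0 x)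
    · exact (hg (x 1)).comp_hasFDerivAt x (hasFDerivAt_apply 1 x)
    · exact (hh (x 0)).comp_hasFDerivAt x (hasFDerivAt_apply 0 x)
  constructor <;>
  · funext x k
    rw [pd, (key x).fderiv]
    fin_cases k <;> simp

theorem statement1 (β : ℝ) (hβ : 0 < β)
    (Ω : Set (Fin 2 → ℝ)) (hΩ : MeasurableSet Ω)
    (hΩpos : 0 < volume Ω) (hΩfin : volume Ω < ⊤)
    (Z : Matrix (Fin 2) (Fin 2) ℝ) (hZ : Z = Matrix.of ![![1, 0], ![0, 0]])
    (u : (Fin 2 → ℝ) → (Fin 3 → ℝ))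
    (hu : u = fun x => ![Real.sin (x 0), (1 + 1/(5*β)) * x 1, Real.cos (x 0)]) :
    Etilde Ω Z u = -(volume Ω).toReal / (5*β) := by
  subst hu hZ
  set c : ℝ := 1 + 1 / (5 * β) with hc
  obtain ⟨h0, h1⟩ := pd_of_hasDerivAt (g := fun t => c * t) (g' := fun _ => c)
    Real.hasDerivAt_sin (fun t => by simpa using (hasDerivAt_id t).const_mul c)
    Real.hasDerivAt_cos
  obtain ⟨h00, h10⟩ := pd_of_hasDerivAt (g := fun _ => 0) (g' := fun _ => 0)
    (h := fun t => -Real.sin t) Real.hasDerivAt_cos (fun t => hasDerivAt_const t 0) (fun t => (Real.hasDerivAt_sin t).neg)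
  obtain ⟨h01, h11⟩ := pd_of_hasDerivAt (f := fun _ => 0) (f' := fun _ => 0)
    (g := fun _ => c) (g' := fun _ => 0) (h := fun _ => 0) (h' := fun _ => 0)
    (fun t => hasDerivAt_const t 0) (fun t => hasDerivAt_const t c)
    (fun t => hasDerivAt_const t 0)
  have hpd2 (i j : Fin 2) (v : (Fin 2 → ℝ) → (Fin 3 → ℝ)) : pd2 i j v = pd i (pd j v) := rfl
  have hH (x : Fin 2 → ℝ) :
      -(Real.sin (x 0) * (Real.sin (x 0) * c)) + -(Real.cos (x 0) * (Real.cos (x 0) * c)) = -c := by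
    linear_combination -c * Real.sin_sq_add_cos_sq (x 0)
  simp only [Etilde, hpd2, nrm, frob2sq, Fin.sum_univ_two, Fin.sum_univ_three, h0, h1, h00, h10,
    h01, h11, crossProduct]
  simp [hH, measureReal_def]
  rw [hc]
  field_simp
  ring

end
end

section
/- Let Ω ⊂ ℝ² be open, Z ∈ ℝ^{2×2}, and let u : Ω → ℝ³ be a C² map satisfying (∇u(x))ᵀ∇u(x) = Id₂ for all x ∈ Ω. Then the pointwise identity ½|H(u)(x) + Z|²_F = ½|D²u(x)|² + Σ_{i,j=1}^{2} ∂ᵢⱼu(x)·(∂₁u(x) × ∂₂u(x))·Zᵢⱼ + ½|Z|²_F holds for all x ∈ Ω, where H(u) is the second fundamental form of u. -/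
open MeasureTheory Matrix

noncomputable section

/-- A vector orthogonal to two orthonormal vectors of `ℝ³` has the norm of its component along
their cross product. -/
lemma sq_sum_cross_mul_eq_sum_sq {a b w : Fin 3 → ℝ} (haa : a ⬝ᵥ a = 1) (hbb : b ⬝ᵥ b = 1)
    (hab : a ⬝ᵥ b = 0) (haw : a ⬝ᵥ w = 0) (hbw : b ⬝ᵥ w = 0) :
    (∑ k, crossProduct a b k * w k) ^ 2 = ∑ k, w k ^ 2 := by
  simp only [dotProduct, Fin.sum_univ_three] at *
  simp only [cross_apply, cons_val]
  linear_combination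
    ((b 0 * b 0 + b 1 * b 1 + b 2 * b 2) * (w 0 ^ 2 + w 1 ^ 2 + w 2 ^ 2)) * haa
    + (w 0 ^ 2 + w 1 ^ 2 + w 2 ^ 2) * hbb
    - ((a 0 * a 0 + a 1 * a 1 + a 2 * a 2) * (b 0 * w 0 + b 1 * w 1 + b 2 * w 2)) * hbw
    - ((b 0 * b 0 + b 1 * b 1 + b 2 * b 2) * (a 0 * w 0 + a 1 * w 1 + a 2 * w 2)) * haw
    - ((a 0 * b 0 + a 1 * b 1 + a 2 * b 2) * (w 0 ^ 2 + w 1 ^ 2 + w 2 ^ 2)) * hab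
    + 2 * ((a 0 * b 0 + a 1 * b 1 + a 2 * b 2) * (a 0 * w 0 + a 1 * w 1 + a 2 * w 2)) * hbw

lemma ContDiffAt.differentiableAt_fderiv_of_two {u : (Fin 2 → ℝ) → (Fin 3 → ℝ)} {x : Fin 2 → ℝ}
    (hu : ContDiffAt ℝ 2 u x) : DifferentiableAt ℝ (fderiv ℝ u) x :=
  (hu.fderiv_right (m := 1) (by norm_num)).differentiableAt (by norm_num)

lemma differentiableAt_pd {u : (Fin 2 → ℝ) → (Fin 3 → ℝ)} {x : Fin 2 → ℝ}
    (hu : ContDiffAt ℝ 2 u x) (i : Fin 2) : DifferentiableAt ℝ (pd i u) x :=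
  hu.differentiableAt_fderiv_of_two.clm_apply (differentiableAt_const _)

lemma pd2_eq_fderiv_fderiv {u : (Fin 2 → ℝ) → (Fin 3 → ℝ)} {x : Fin 2 → ℝ}
    (hu : ContDiffAt ℝ 2 u x) (i j : Fin 2) :
    pd2 i j u x = fderiv ℝ (fderiv ℝ u) x (Pi.single i 1) (Pi.single j 1) := by
  have h : pd j u = fun y => fderiv ℝ u y (Pi.single j 1) := rfl
  rw [pd2, h, fderiv_clm_apply hu.differentiableAt_fderiv_of_two (differentiableAt_const _)]
  simp

lemma pd2_comm {u : (Fin 2 → ℝ) → (Fin 3 → ℝ)} {x : Fin 2 → ℝ}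
    (hu : ContDiffAt ℝ 2 u x) (i j : Fin 2) : pd2 i j u x = pd2 j i u x := by
  rw [pd2_eq_fderiv_fderiv hu, pd2_eq_fderiv_fderiv hu]
  exact (hu.isSymmSndFDerivAt (by simp)).eq _ _

lemma pd_dotProduct_pd {u : (Fin 2 → ℝ) → (Fin 3 → ℝ)} {x : Fin 2 → ℝ}
    (h : (grad u x)ᵀ * grad u x = 1) (i j : Fin 2) :
    pd i u x ⬝ᵥ pd j u x = (1 : Matrix (Fin 2) (Fin 2) ℝ) i j := by
  rw [← h]
  simp [Matrix.mul_apply, grad, dotProduct]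

/-- Product rule applied to a locally constant first fundamental form. -/
lemma pd2_dotProduct_pd_add {u : (Fin 2 → ℝ) → (Fin 3 → ℝ)} {x : Fin 2 → ℝ}
    (hu : ContDiffAt ℝ 2 u x) {i j : Fin 2} {c : ℝ}
    (h : ∀ᶠ y in nhds x, pd i u y ⬝ᵥ pd j u y = c) (k : Fin 2) :
    pd2 k i u x ⬝ᵥ pd j u x + pd i u x ⬝ᵥ pd2 k j u x = 0 := by
  have hi := hasFDerivAt_pi'.1 (differentiableAt_pd hu i).hasFDerivAt
  have hj := hasFDerivAt_pi'.1 (differentiableAt_pd hu j).hasFDerivAt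
  have hsum := HasFDerivAt.fun_sum (u := Finset.univ) fun a _ => (hi a).mul (hj a)
  have hconst : HasFDerivAt (fun y => ∑ a, pd i u y a * pd j u y a)
      (0 : (Fin 2 → ℝ) →L[ℝ] ℝ) x :=
    (hasFDerivAt_const c x).congr_of_eventuallyEq h
  have key := DFunLike.congr_fun (hsum.unique hconst) (Pi.single k 1)
  simp [Fin.sum_univ_three] at key
  simp only [dotProduct, Fin.sum_univ_three, pd2]
  linear_combination key

/-- For an isometric map the second derivatives are normal: the Christoffel symbols vanish. -/
lemma pd_dotProduct_pd2_eq_zero {u : (Fin 2 → ℝ) → (Fin 3 → ℝ)} {x : Fin 2 → ℝ}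
    (hu : ContDiffAt ℝ 2 u x) (h : ∀ᶠ y in nhds x, (grad u y)ᵀ * grad u y = 1)
    (k i j : Fin 2) : pd k u x ⬝ᵥ pd2 i j u x = 0 := by
  have key (p q r : Fin 2) : pd q u x ⬝ᵥ pd2 r p u x + pd p u x ⬝ᵥ pd2 r q u x = 0 := by
    rw [dotProduct_comm (pd q u x)]
    exact pd2_dotProduct_pd_add hu (h.mono fun y hy => pd_dotProduct_pd hy p q) r
  have h₁ := key k j i
  have h₂ := key i k j
  have h₃ := key i j k
  rw [pd2_comm hu j i] at h₂
  rw [pd2_comm hu k i] at h₃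
  rw [pd2_comm hu k j] at h₃
  linarith

theorem statement7 (Ω : Set (Fin 2 → ℝ)) (hΩ : IsOpen Ω)
    (Z : Matrix (Fin 2) (Fin 2) ℝ)
    (u : (Fin 2 → ℝ) → (Fin 3 → ℝ)) (hu : ContDiffOn ℝ 2 u Ω)
    (hiso : ∀ x ∈ Ω, (grad u x)ᵀ * grad u x = 1) :
    ∀ x ∈ Ω,
      (1/2) * frob2sq (sff u x + Z)
        = (1/2) * (∑ i, ∑ j, ∑ k, (pd2 i j u x k) ^ 2)
          + (∑ i, ∑ j, (∑ k, pd2 i j u x k * nrm u x k) * Z i j)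
          + (1/2) * frob2sq Z := by
  intro x hx
  have hux : ContDiffAt ℝ 2 u x := hu.contDiffAt (hΩ.mem_nhds hx)
  have hev : ∀ᶠ y in nhds x, (grad u y)ᵀ * grad u y = 1 :=
    Filter.eventually_of_mem (hΩ.mem_nhds hx) hiso
  have hsq (i j : Fin 2) : (∑ k, nrm u x k * pd2 i j u x k) ^ 2 = ∑ k, pd2 i j u x k ^ 2 :=
    sq_sum_cross_mul_eq_sum_sq
      (by simp [pd_dotProduct_pd (hiso x hx)]) (by simp [pd_dotProduct_pd (hiso x hx)])
      (by simp [pd_dotProduct_pd (hiso x hx)])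
      (pd_dotProduct_pd2_eq_zero hux hev 0 i j) (pd_dotProduct_pd2_eq_zero hux hev 1 i j)
  simp only [frob2sq, sff, Matrix.add_apply, Matrix.of_apply, ← hsq, mul_comm (pd2 _ _ u x _),
    Fin.sum_univ_two]
  ring

end
end

section
/- Let β > 0 and γ > 0, let Ω ⊂ ℝ² be a measurable set of finite positive Lebesgue measure |Ω|, let Z ∈ ℝ^{2×2} have entries Z₁₁ = β^γ and Zᵢⱼ = 0 otherwise, and let ũ(x₁,x₂) = (β^{−γ} sin(β^γ x₁), (1+β^{−2γ})·x₂, β^{−γ} cos(β^γ x₁)). Then the reshaped energy satisfies Ẽ[ũ] = ½∫_Ω |D²ũ|² dx + Σ_{i,j=1}^{2} ∫_Ω ∂ᵢⱼũ·(∂₁ũ × ∂₂ũ) Zᵢⱼ dx + ½|Ω||Z|²_F = −|Ω|. -/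
open MeasureTheory Matrix

noncomputable section

/-- The map `(x₁, x₂) ↦ (f x₁, c x₂, g x₁)`, a surface ruled over the curve `(f, g)`. -/
def ruledMap (f g : ℝ → ℝ) (c : ℝ) (x : Fin 2 → ℝ) : Fin 3 → ℝ :=
  ![f (x 0), c * x 1, g (x 0)]

theorem pd_vec {f g h : (Fin 2 → ℝ) → ℝ} {f' g' h' : (Fin 2 → ℝ) →L[ℝ] ℝ} {x : Fin 2 → ℝ}
    (hf : HasFDerivAt f f' x) (hg : HasFDerivAt g g' x) (hh : HasFDerivAt h h' x) (i : Fin 2) :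
    pd i (fun y => ![f y, g y, h y]) x =
      ![f' (Pi.single i 1), g' (Pi.single i 1), h' (Pi.single i 1)] := by
  have H : HasFDerivAt (fun y => ![f y, g y, h y]) (ContinuousLinearMap.pi ![f', g', h']) x := by
    rw [hasFDerivAt_pi']
    intro k
    fin_cases k <;> simpa using by assumption
  rw [pd, H.fderiv]
  ext k
  fin_cases k <;> rfl

theorem hasFDerivAt_comp_apply {f : ℝ → ℝ} {d : ℝ} {j : Fin 2} {x : Fin 2 → ℝ}
    (hf : HasDerivAt f d (x j)) :
    HasFDerivAt (fun y : Fin 2 → ℝ => f (y j))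
      (d • ContinuousLinearMap.proj (R := ℝ) (φ := fun _ : Fin 2 => ℝ) j) x :=
  hf.comp_hasFDerivAt x (hasFDerivAt_apply j x)

theorem pd_zero_ruledMap {f g f' g' : ℝ → ℝ} (c : ℝ) (hf : ∀ t, HasDerivAt f (f' t) t)
    (hg : ∀ t, HasDerivAt g (g' t) t) :
    pd 0 (ruledMap f g c) = fun x => ![f' (x 0), 0, g' (x 0)] := by
  funext x
  refine (pd_vec (hasFDerivAt_comp_apply (hf (x 0)))
    (hasFDerivAt_comp_apply (j := 1) ((hasDerivAt_id _).const_mul c))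
    (hasFDerivAt_comp_apply (hg (x 0))) 0).trans ?_
  simp

theorem pd_one_ruledMap {f g f' g' : ℝ → ℝ} (c : ℝ) (hf : ∀ t, HasDerivAt f (f' t) t)
    (hg : ∀ t, HasDerivAt g (g' t) t) :
    pd 1 (ruledMap f g c) = fun _ => ![0, c, 0] := by
  funext x
  refine (pd_vec (hasFDerivAt_comp_apply (hf (x 0)))
    (hasFDerivAt_comp_apply (j := 1) ((hasDerivAt_id _).const_mul c))
    (hasFDerivAt_comp_apply (hg (x 0))) 1).trans ?_
  simp

theorem pd2_ruledMap {f g f' g' f'' g'' : ℝ → ℝ} (c : ℝ) (hf : ∀ t, HasDerivAt f (f' t) t)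
    (hg : ∀ t, HasDerivAt g (g' t) t) (hf' : ∀ t, HasDerivAt f' (f'' t) t)
    (hg' : ∀ t, HasDerivAt g' (g'' t) t) (i j : Fin 2) (x : Fin 2 → ℝ) :
    pd2 i j (ruledMap f g c) x =
      if i = 0 ∧ j = 0 then ![f'' (x 0), 0, g'' (x 0)] else 0 := by
  have h0 : pd 0 (ruledMap f g c) = ruledMap f' g' 0 := by
    rw [pd_zero_ruledMap c hf hg]
    simp [ruledMap, funext_iff]
  have h1 := pd_one_ruledMap c hf hg
  change pd i (pd j (ruledMap f g c)) x = _
  fin_cases j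
  · simp only [Fin.zero_eta, h0]
    fin_cases i
    · simp [pd_zero_ruledMap 0 hf' hg']
    · simp [pd_one_ruledMap 0 hf' hg']
  · simp [h1, pd]

theorem nrm_ruledMap {f g f' g' : ℝ → ℝ} (c : ℝ) (hf : ∀ t, HasDerivAt f (f' t) t)
    (hg : ∀ t, HasDerivAt g (g' t) t) (x : Fin 2 → ℝ) :
    nrm (ruledMap f g c) x = ![-(g' (x 0) * c), 0, f' (x 0) * c] := by
  simp [nrm, pd_zero_ruledMap c hf hg, pd_one_ruledMap c hf hg, cross_apply]

theorem Etilde_cylinder {a : ℝ} (ha : a ≠ 0) (c : ℝ) (Ω : Set (Fin 2 → ℝ)) :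
    Etilde Ω (Matrix.of ![![a, 0], ![0, 0]])
        (ruledMap (fun t => a⁻¹ * Real.sin (a * t)) (fun t => a⁻¹ * Real.cos (a * t)) c) =
      (1 - c) * a ^ 2 * (volume Ω).toReal := by
  have hs (t : ℝ) : HasDerivAt (fun t => Real.sin (a * t)) (a * Real.cos (a * t)) t := by
    simpa [mul_comm] using ((hasDerivAt_id t).const_mul a).sin
  have hc (t : ℝ) : HasDerivAt (fun t => Real.cos (a * t)) (-(a * Real.sin (a * t))) t := by
    simpa [mul_comm] using ((hasDerivAt_id t).const_mul a).cos
  have hf (t : ℝ) : HasDerivAt (fun t => a⁻¹ * Real.sin (a * t)) (Real.cos (a * t)) t := by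
    simpa [ha] using (hs t).const_mul a⁻¹
  have hg (t : ℝ) : HasDerivAt (fun t => a⁻¹ * Real.cos (a * t)) (-Real.sin (a * t)) t := by
    simpa [ha] using (hc t).const_mul a⁻¹
  have hd := pd2_ruledMap c hf hg hc fun t => (hs t).neg
  have hsq (t : ℝ) : (a * Real.sin t) ^ 2 + (a * Real.cos t) ^ 2 = a ^ 2 := by
    linear_combination a ^ 2 * Real.sin_sq_add_cos_sq t
  have hdot (t : ℝ) : -(a * Real.sin t * (Real.sin t * c)) + -(a * Real.cos t * (Real.cos t * c)) =
      -(a * c) := by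
    linear_combination -(a * c) * Real.sin_sq_add_cos_sq t
  simp [Etilde, frob2sq, hd, nrm_ruledMap c hf hg, Fin.sum_univ_succ, hsq, hdot, Measure.real]
  ring

theorem statement9 (β γ : ℝ) (hβ : 0 < β) (hγ : 0 < γ)
    (Ω : Set (Fin 2 → ℝ)) (hΩ : MeasurableSet Ω)
    (hΩpos : 0 < volume Ω) (hΩfin : volume Ω < ⊤)
    (Z : Matrix (Fin 2) (Fin 2) ℝ) (hZ : Z = Matrix.of ![![β ^ γ, 0], ![0, 0]])
    (u : (Fin 2 → ℝ) → (Fin 3 → ℝ))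
    (hu : u = fun x => ![β ^ (-γ) * Real.sin (β ^ γ * x 0), (1 + β ^ (-(2*γ))) * x 1, β ^ (-γ) * Real.cos (β ^ γ * x 0)]) :
    Etilde Ω Z u = -(volume Ω).toReal := by
  have ha : β ^ γ ≠ 0 := (Real.rpow_pos_of_pos hβ γ).ne'
  have hinv : β ^ (-(2 * γ)) = ((β ^ γ) ^ 2)⁻¹ := by
    rw [Real.rpow_neg hβ.le, mul_comm, Real.rpow_mul hβ.le, Real.rpow_two]
  rw [Real.rpow_neg hβ.le, hinv] at hu
  rw [hu, hZ]
  refine (Etilde_cylinder ha _ Ω).trans ?_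
  field_simp
  ring

end
end
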